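/- Let χ be a countable set of cadlag F^o-adapted real processes which are uniformly bounded on each interval [0,T]. Let (s,η) ∈ Λ, let ℙ ∈ MP^{s,η}(χ), fix t ≥ s, and let (Q^{t,ζ})_{ζ∈Ω} be a regular conditional probability of ℙ given F_t. Then for ℙ-almost all ζ, Q^{t,ζ}(ω^t = ζ^t) = 1 and every element of χ is a (Q^{t,ζ},F^o)-martingale on [t,+∞); that is, Q^{t,ζ} solves the martingale problem with respect to χ starting in (t,ζ^t). -/

import Mathlib

open MeasureTheory Filter Topology Set
open scoped NNReal ENNReal

noncomputable section

/-- A function indexed by `ℝ≥0` is *cadlag* if it is right-continuous and has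
left limits at every positive time. -/
def IsCadlag {X : Type*} [TopologicalSpace X] (f : ℝ≥0 → X) : Prop :=
  (∀ t : ℝ≥0, Tendsto f (𝓝[Set.Ici t] t) (𝓝 (f t))) ∧
    ∀ t : ℝ≥0, 0 < t → ∃ l : X, Tendsto f (𝓝[Set.Iio t] t) (𝓝 l)

variable (E : Type*) [MetricSpace E] [MeasurableSpace E]

/-- The canonical path space `Ω = D(ℝ₊, E)` of cadlag paths with values in `E`. -/
def PathOmega := {f : ℝ≥0 → E // IsCadlag f}

/-- The canonical σ-field `𝓕 = σ(X_r ; r ≥ 0)` on the path space. -/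
instance instPathOmegaMS : MeasurableSpace (PathOmega E) :=
  ⨆ r : ℝ≥0, MeasurableSpace.comap (fun ω : PathOmega E => ω.1 r) inferInstance

/-- The initial filtration `𝓕^o_t = σ(X_r ; r ≤ t)`. -/
def Fot (t : ℝ≥0) : MeasurableSpace (PathOmega E) :=
  ⨆ r ∈ Set.Iic t, MeasurableSpace.comap (fun ω : PathOmega E => ω.1 r) inferInstance

/-- The canonical (right-continuous) filtration `𝓕_t = ⋂_{s > t} 𝓕^o_s`. -/
def Ft (t : ℝ≥0) : MeasurableSpace (PathOmega E) :=
  ⨅ u ∈ Set.Ioi t, Fot E u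

variable {E}

/-- A *path-dependent canonical class*. -/
structure IsPathCanonicalClass (P : ℝ≥0 → PathOmega E → Measure (PathOmega E)) : Prop where
  isProb : ∀ s η, IsProbabilityMeasure (P s η)
  starts : ∀ (s : ℝ≥0) (η : PathOmega E), P s η {ω | ∀ r ≤ s, ω.1 r = η.1 r} = 1
  fos_meas : ∀ (s : ℝ≥0) (F : Set (PathOmega E)), MeasurableSet F →
    Measurable[Fot E s] fun η => P s η F
  cond : ∀ (s : ℝ≥0) (η : PathOmega E) (t : ℝ≥0), s ≤ t →
    ∀ F : Set (PathOmega E), MeasurableSet F →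
      ∀ G : Set (PathOmega E), MeasurableSet[Fot E t] G →
        ∫⁻ ω in G, P t ω F ∂(P s η) = P s η (F ∩ G)

variable (E)


/-- A process `M` is a martingale on `[s, ∞)` with respect to the measure `μ`
and the filtration `𝔽`: it is integrable at each time `t ≥ s` and has the
martingale property for `s ≤ t ≤ u`, expressed through set integrals over
`𝔽 t`-measurable events. -/
def IsMartingaleOn (μ : Measure (PathOmega E))
    (𝔽 : ℝ≥0 → MeasurableSpace (PathOmega E))
    (M : ℝ≥0 → PathOmega E → ℝ) (s : ℝ≥0) : Prop :=
  (∀ t : ℝ≥0, s ≤ t → Integrable (M t) μ) ∧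
    ∀ t u : ℝ≥0, s ≤ t → t ≤ u → ∀ G : Set (PathOmega E), MeasurableSet[𝔽 t] G →
      ∫ ω in G, M u ω ∂μ = ∫ ω in G, M t ω ∂μ


/-- A probability measure `μ` solves the martingale problem with respect to a
set of processes `χ` starting in `(s,η)`: `μ(ω^s = η^s) = 1` and every element
of `χ` is a `(μ, 𝓕^o)`-martingale on `[s, ∞)`. -/
def SolvesMP (χ : Set (ℝ≥0 → PathOmega E → ℝ)) (s : ℝ≥0) (η : PathOmega E)
    (μ : Measure (PathOmega E)) : Prop :=
  μ {ω | ∀ r ≤ s, ω.1 r = η.1 r} = 1 ∧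
    ∀ M ∈ χ, IsMartingaleOn E μ (Fot E) M s

/-- A countable generating family of a σ-algebra can be enlarged to a countable π-system. -/
lemma exists_countable_piSystem {Ω ι : Type*} [Countable ι] (A : ι → Set Ω) :
    ∃ S : Set (Set Ω), S.Countable ∧ IsPiSystem S ∧ univ ∈ S ∧
      MeasurableSpace.generateFrom S = MeasurableSpace.generateFrom (range A) := by
  classical
  refine ⟨range fun s : Finset ι => ⋂ i ∈ s, A i, countable_range _, ?_, ⟨∅, by simp⟩, ?_⟩
  · rintro _ ⟨s, rfl⟩ _ ⟨s', rfl⟩ -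
    exact ⟨s ∪ s', Finset.iInf_union⟩
  · refine le_antisymm (MeasurableSpace.generateFrom_le ?_) (MeasurableSpace.generateFrom_mono ?_)
    · rintro _ ⟨s, rfl⟩
      exact Finset.measurableSet_biInter s fun i _ =>
        MeasurableSpace.measurableSet_generateFrom ⟨i, rfl⟩
    · rintro _ ⟨i, rfl⟩
      exact ⟨{i}, by simp⟩

/-- If an integrable function has vanishing integral over a π-system containing the whole space,
then it has vanishing integral over every set of the generated σ-algebra. -/
lemma setIntegral_eq_zero_of_piSystem {Ω : Type*} {m m0 : MeasurableSpace Ω} (hm : m ≤ m0)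
    {P : Measure Ω} {f : Ω → ℝ} (hf : Integrable f P) {S : Set (Set Ω)}
    (hS : m = MeasurableSpace.generateFrom S) (hpi : IsPiSystem S) (huniv : univ ∈ S)
    (h : ∀ G ∈ S, ∫ ω in G, f ω ∂P = 0) (G : Set Ω) (hG : MeasurableSet[m] G) :
    ∫ ω in G, f ω ∂P = 0 := by
  induction G, hG using MeasurableSpace.induction_on_inter hS hpi with
  | empty => simp
  | basic G hG => exact h G hG
  | compl G hG ih =>
    have hu := h univ huniv
    rw [setIntegral_univ] at hu
    rw [setIntegral_compl (hm _ hG) hf, ih, hu, sub_zero]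
  | iUnion F hd hF ih =>
    rw [integral_iUnion (fun i => hm _ (hF i)) hd hf.integrableOn]
    simp [ih]

section Disintegration

variable {Ω : Type*} {m m0 : MeasurableSpace Ω} {μ : Measure Ω} {Q : Ω → Measure Ω}

/-- A regular conditional probability charges almost surely only those sets of the conditioning
σ-algebra that contain the conditioning point. -/
lemma ae_mem_imp_ae_mem (hm : m ≤ m0)
    (hQmeas : ∀ F : Set Ω, MeasurableSet F → Measurable[m] fun ζ => Q ζ F)
    (hQcond : ∀ F : Set Ω, MeasurableSet F → ∀ G : Set Ω, MeasurableSet[m] G →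
      ∫⁻ ζ in G, Q ζ F ∂μ = μ (F ∩ G))
    {A : Set Ω} (hA : MeasurableSet[m] A) :
    ∀ᵐ ζ ∂μ, ζ ∈ A → ∀ᵐ ω ∂(Q ζ), ω ∈ A := by
  have hA' : MeasurableSet Aᶜ := (hm _ hA).compl
  have h := hQcond Aᶜ hA' A hA
  rw [compl_inter_self, measure_empty,
    setLIntegral_eq_zero_iff (hm _ hA) ((hQmeas _ hA').mono hm le_rfl)] at h
  exact h

/-- If a bounded function has vanishing integral over every set of the conditioning σ-algebra,
then its integral against the regular conditional probability vanishes almost surely. -/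
lemma ae_integral_eq_zero [IsProbabilityMeasure μ] (hm : m ≤ m0)
    (hQprob : ∀ ζ, IsProbabilityMeasure (Q ζ))
    (hQmeas : ∀ F : Set Ω, MeasurableSet F → Measurable[m] fun ζ => Q ζ F)
    (hQcond : ∀ F : Set Ω, MeasurableSet F → ∀ G : Set Ω, MeasurableSet[m] G →
      ∫⁻ ζ in G, Q ζ F ∂μ = μ (F ∩ G))
    {f : Ω → ℝ} (hf : Measurable f) {C : ℝ} (hC : ∀ ω, |f ω| ≤ C)
    (h : ∀ H, MeasurableSet[m] H → ∫ ω in H, f ω ∂μ = 0) :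
    ∀ᵐ ζ ∂μ, ∫ ω, f ω ∂(Q ζ) = 0 := by
  have hQm : Measurable[m] Q := Measure.measurable_of_measurable_coe _ hQmeas
  have hsm : StronglyMeasurable[m] fun ζ => ∫ ω, f ω ∂(Q ζ) :=
    StronglyMeasurable.integral_kernel (κ := @ProbabilityTheory.Kernel.mk Ω Ω m m0 Q hQm)
      hf.stronglyMeasurable
  let κ : ProbabilityTheory.Kernel Ω Ω := ⟨Q, hQm.mono hm le_rfl⟩
  have hint : Integrable (fun ζ => ∫ ω, f ω ∂(Q ζ)) μ := by
    refine Integrable.of_bound (C := C) (hsm.mono hm).aestronglyMeasurable (ae_of_all _ fun ζ => ?_)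
    have := norm_integral_le_of_norm_le_const (μ := Q ζ) (f := f) (ae_of_all _ hC)
    simpa using this
  refine ae_eq_of_forall_setIntegral_eq_of_sigmaFinite' hm (g := 0)
    (fun H _ _ => hint.integrableOn) (fun H _ _ => integrableOn_zero) (fun H hH _ => ?_)
    hsm.aestronglyMeasurable aestronglyMeasurable_zero
  have hcomp : (κ.comp (.const Unit (μ.restrict H))) () = μ.restrict H := by
    ext F hF
    rw [ProbabilityTheory.Kernel.comp_apply' _ _ _ hF, Measure.restrict_apply hF]
    exact hQcond F hF H hH
  have hf' : Integrable f ((κ.comp (.const Unit (μ.restrict H))) ()) := by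
    rw [hcomp]
    exact Integrable.of_bound hf.aestronglyMeasurable C (ae_of_all _ hC)
  have hcalc := ProbabilityTheory.Kernel.integral_comp hf'
  rw [hcomp, h H hH] at hcalc
  simpa [κ] using hcalc.symm

end Disintegration

section PathSpace

variable {E}

lemma IsCadlag.tendsto_of_seq {X : Type*} [TopologicalSpace X] {f : ℝ≥0 → X} (hf : IsCadlag f)
    {r : ℝ≥0} {q : ℕ → ℝ≥0} (hq : Tendsto q atTop (𝓝 r)) (hle : ∀ n, r ≤ q n) :
    Tendsto (fun n => f (q n)) atTop (𝓝 (f r)) :=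
  (hf.1 r).comp (tendsto_nhdsWithin_iff.2 ⟨hq, Eventually.of_forall hle⟩)

/-- Two cadlag functions agreeing at `u` and on a dense subset of `[0, u]` agree on `[0, u]`. -/
lemma IsCadlag.eq_of_eq_on_dense {X : Type*} [TopologicalSpace X] [T2Space X] {f g : ℝ≥0 → X}
    (hf : IsCadlag f) (hg : IsCadlag g) {D : Set ℝ≥0} (hD : Dense D) {u : ℝ≥0}
    (h : ∀ q ∈ D ∩ Iic u ∪ {u}, f q = g q) {r : ℝ≥0} (hr : r ≤ u) : f r = g r := by
  rcases hr.eq_or_lt with rfl | hr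
  · exact h r (Or.inr rfl)
  obtain ⟨q, -, hq, hlim⟩ := hD.exists_seq_strictAnti_tendsto_of_lt hr
  refine tendsto_nhds_unique (hf.tendsto_of_seq hlim fun n => (hq n).1.1.le) ?_
  simp_rw [fun n => h (q n) (Or.inl ⟨(hq n).2, (hq n).1.2.le⟩)]
  exact hg.tendsto_of_seq hlim fun n => (hq n).1.1.le

lemma Fot_mono {u v : ℝ≥0} (h : u ≤ v) : Fot E u ≤ Fot E v :=
  biSup_mono fun _ hr => le_trans hr h

lemma Fot_le (u : ℝ≥0) : Fot E u ≤ instPathOmegaMS E :=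
  iSup₂_le fun r _ => le_iSup
    (fun r : ℝ≥0 => MeasurableSpace.comap (fun ω : PathOmega E => ω.1 r) inferInstance) r

lemma Ft_le_Fot {t u : ℝ≥0} (h : t < u) : Ft E t ≤ Fot E u := iInf₂_le u h

lemma Fot_le_Ft (t : ℝ≥0) : Fot E t ≤ Ft E t := le_iInf₂ fun _ hu => Fot_mono (le_of_lt hu)

lemma Ft_le (t : ℝ≥0) : Ft E t ≤ instPathOmegaMS E :=
  (Ft_le_Fot (lt_add_one t)).trans (Fot_le _)

lemma measurable_Fot_coord {r u : ℝ≥0} (h : r ≤ u) :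
    Measurable[Fot E u] fun ω : PathOmega E => ω.1 r :=
  measurable_iff_comap_le.2 (le_iSup₂_of_le r h le_rfl)

/-- The σ-algebra `𝓕^o_u` is generated by a countable π-system. -/
lemma Fot_exists_countable_piSystem [TopologicalSpace.SeparableSpace E] [BorelSpace E]
    (u : ℝ≥0) : ∃ S : Set (Set (PathOmega E)), S.Countable ∧ IsPiSystem S ∧ univ ∈ S ∧
      Fot E u = MeasurableSpace.generateFrom S := by
  have := UniformSpace.secondCountable_of_separable E
  obtain ⟨D, hDc, hD⟩ := TopologicalSpace.exists_countable_dense ℝ≥0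
  let D' : Set ℝ≥0 := D ∩ Iic u ∪ {u}
  have hD'c : D'.Countable := (hDc.mono inter_subset_left).union (countable_singleton u)
  have hD'le : ∀ q ∈ D', q ≤ u := by
    rintro q (hq | rfl)
    exacts [hq.2, le_rfl]
  have := hD'c.to_subtype
  have := (TopologicalSpace.countable_countableBasis E).to_subtype
  let A : D' × TopologicalSpace.countableBasis E → Set (PathOmega E) :=
    fun p => (fun ω : PathOmega E => ω.1 p.1) ⁻¹' p.2
  obtain ⟨S, hSc, hpi, huniv, hS⟩ := exists_countable_piSystem A
  refine ⟨S, hSc, hpi, huniv, ?_⟩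
  rw [hS]
  refine le_antisymm (iSup₂_le fun r hr => ?_) (MeasurableSpace.generateFrom_le ?_)
  · rw [← measurable_iff_comap_le]
    have hmeas : ∀ q ∈ D', Measurable[MeasurableSpace.generateFrom (range A)]
        fun ω : PathOmega E => ω.1 q := by
      intro q hq
      have hE : ‹MeasurableSpace E› =
          MeasurableSpace.generateFrom (TopologicalSpace.countableBasis E) :=
        (BorelSpace.measurable_eq (α := E)).trans
          (TopologicalSpace.isBasis_countableBasis E).borel_eq_generateFrom
      intro B hB
      rw [hE] at hB
      refine @measurable_generateFrom _ _ (MeasurableSpace.generateFrom (range A)) _ _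
        (fun U hU => ?_) B hB
      exact MeasurableSpace.measurableSet_generateFrom ⟨(⟨q, hq⟩, ⟨U, hU⟩), rfl⟩
    rcases (mem_Iic.1 hr).eq_or_lt with rfl | hr
    · exact hmeas r (Or.inr rfl)
    obtain ⟨q, -, hq, hlim⟩ := hD.exists_seq_strictAnti_tendsto_of_lt hr
    refine @measurable_of_tendsto_metrizable _ _ (MeasurableSpace.generateFrom (range A)) _ _ _ _
      (fun n ω => ω.1 (q n)) _ (fun n => hmeas _ (Or.inl ⟨(hq n).2, (hq n).1.2.le⟩)) ?_
    exact tendsto_pi_nhds.2 fun ω => ω.2.tendsto_of_seq hlim fun n => (hq n).1.1.le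
  · rintro _ ⟨⟨⟨q, hq⟩, ⟨U, hU⟩⟩, rfl⟩
    exact measurable_Fot_coord (hD'le q hq)
      ((TopologicalSpace.isBasis_countableBasis E).isOpen hU).measurableSet

/-- A regular conditional probability given `𝓕_t` is almost surely carried by the paths that
agree with the conditioning path up to time `t`. -/
lemma ae_ae_eq_path [TopologicalSpace.SeparableSpace E] [BorelSpace E]
    {μ : Measure (PathOmega E)} {t : ℝ≥0} {Q : PathOmega E → Measure (PathOmega E)}
    (hQmeas : ∀ F : Set (PathOmega E), MeasurableSet F → Measurable[Ft E t] fun ζ => Q ζ F)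
    (hQcond : ∀ F : Set (PathOmega E), MeasurableSet F →
      ∀ G : Set (PathOmega E), MeasurableSet[Ft E t] G → ∫⁻ ζ in G, Q ζ F ∂μ = μ (F ∩ G)) :
    ∀ᵐ ζ ∂μ, ∀ᵐ ω ∂(Q ζ), ∀ r ≤ t, ω.1 r = ζ.1 r := by
  have := UniformSpace.secondCountable_of_separable E
  obtain ⟨D, hDc, hD⟩ := TopologicalSpace.exists_countable_dense ℝ≥0
  have hD'c : (D ∩ Iic t ∪ {t}).Countable :=
    (hDc.mono inter_subset_left).union (countable_singleton t)
  have hD'le : ∀ q ∈ D ∩ Iic t ∪ {t}, q ≤ t := by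
    rintro q (hq | rfl)
    exacts [hq.2, le_rfl]
  have hB := TopologicalSpace.isBasis_countableBasis E
  have hBc := TopologicalSpace.countable_countableBasis E
  have key : ∀ᵐ ζ ∂μ, ∀ q ∈ D ∩ Iic t ∪ {t}, ∀ U ∈ TopologicalSpace.countableBasis E,
      ζ.1 q ∈ U → ∀ᵐ ω ∂(Q ζ), ω.1 q ∈ U := by
    refine (ae_ball_iff hD'c).2 fun q hq => (ae_ball_iff hBc).2 fun U hU => ?_
    exact ae_mem_imp_ae_mem (Ft_le t) hQmeas hQcond
      (A := (fun ω : PathOmega E => ω.1 q) ⁻¹' U)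
      (Fot_le_Ft t _ (measurable_Fot_coord (hD'le q hq) (hB.isOpen hU).measurableSet))
  filter_upwards [key] with ζ hζ
  have : ∀ᵐ ω ∂(Q ζ), ∀ q ∈ D ∩ Iic t ∪ {t}, ∀ U ∈ TopologicalSpace.countableBasis E,
      ζ.1 q ∈ U → ω.1 q ∈ U := by
    refine (ae_ball_iff hD'c).2 fun q hq => (ae_ball_iff hBc).2 fun U hU => ?_
    by_cases h : ζ.1 q ∈ U
    · filter_upwards [hζ q hq U hU h] with ω hω _ using hω
    · exact ae_of_all _ fun ω h' => absurd h' h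
  filter_upwards [this] with ω hω r hr
  refine ω.2.eq_of_eq_on_dense ζ.2 hD (fun q hq => ?_) hr
  by_contra hne
  obtain ⟨U, hU, hmem, hsub⟩ := hB.exists_subset_of_mem_open
    (show ζ.1 q ∈ ({ω.1 q}ᶜ : Set E) from fun h => hne h.symm) isOpen_compl_singleton
  exact hsub (hω q hq U hU hmem) rfl

/-- Set integrals of a locally bounded right-continuous process are right-continuous in time. -/
lemma tendsto_setIntegral_of_cadlag {M : ℝ≥0 → PathOmega E → ℝ}
    (hM : ∀ ω : PathOmega E, IsCadlag fun t => M t ω) (hmeas : ∀ t, Measurable (M t))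
    {C : ℝ} {T : ℝ≥0} (hC : ∀ t ≤ T, ∀ ω, |M t ω| ≤ C)
    (P : Measure (PathOmega E)) [IsFiniteMeasure P] (G : Set (PathOmega E)) {u : ℝ≥0}
    {q : ℕ → ℝ≥0} (hq : Tendsto q atTop (𝓝 u)) (hle : ∀ n, u ≤ q n) (hqT : ∀ n, q n ≤ T) :
    Tendsto (fun n => ∫ ω in G, M (q n) ω ∂P) atTop (𝓝 (∫ ω in G, M u ω ∂P)) :=
  tendsto_integral_of_dominated_convergence (fun _ => C)
    (fun n => (hmeas (q n)).aestronglyMeasurable) (integrable_const C)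
    (fun n => ae_of_all _ (hC _ (hqT n)))
    (ae_of_all _ fun ω => (hM ω).tendsto_of_seq hq hle)

/-- The martingale property of a locally bounded cadlag process on `[t, ∞)` follows from that on
a dense set of times in `(t, ∞)`. -/
lemma isMartingaleOn_of_dense {M : ℝ≥0 → PathOmega E → ℝ}
    (hM : ∀ ω : PathOmega E, IsCadlag fun t => M t ω) (hmeas : ∀ t, Measurable (M t))
    (hbdd : ∀ T : ℝ≥0, ∃ C : ℝ, ∀ t ≤ T, ∀ ω, |M t ω| ≤ C)
    (P : Measure (PathOmega E)) [IsFiniteMeasure P] {D : Set ℝ≥0} (hD : Dense D) {t : ℝ≥0}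
    (h : ∀ q ∈ D, ∀ q' ∈ D, t < q → q < q' → ∀ G, MeasurableSet[Fot E q] G →
      ∫ ω in G, M q' ω ∂P = ∫ ω in G, M q ω ∂P) :
    IsMartingaleOn E P (Fot E) M t := by
  refine ⟨fun u _ => ?_, fun u v htu huv G hG => ?_⟩
  · obtain ⟨C, hC⟩ := hbdd u
    exact Integrable.of_bound (hmeas u).aestronglyMeasurable C (ae_of_all _ (hC u le_rfl))
  rcases huv.eq_or_lt with rfl | huv
  · rfl
  obtain ⟨C, hC⟩ := hbdd (v + 1)
  obtain ⟨q, -, hq, hqlim⟩ := hD.exists_seq_strictAnti_tendsto_of_lt huv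
  obtain ⟨p, -, hp, hplim⟩ := hD.exists_seq_strictAnti_tendsto_of_lt (lt_add_one v)
  refine tendsto_nhds_unique
    (tendsto_setIntegral_of_cadlag hM hmeas hC P G hplim (fun n => (hp n).1.1.le)
      fun n => (hp n).1.2.le) ?_
  simp_rw [fun n => h (q n) (hq n).2 (p n) (hp n).2 (htu.trans_lt (hq n).1.1)
    ((hq n).1.2.trans (hp n).1.1) G (Fot_mono (hq n).1.1.le G hG)]
  exact tendsto_setIntegral_of_cadlag hM hmeas hC P G hqlim (fun n => (hq n).1.1.le)
    fun n => (hq n).1.2.le.trans le_self_add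

end PathSpace

/-- part of the proof of Proposition 4.12: if `ℙ` solves the
martingale problem with respect to `χ` starting in `(s,η) ∈ Λ` and
`(Q^{t,ζ})_{ζ}` is a regular conditional probability of `ℙ` given `𝓕_t`
(`t ≥ s`), then for `ℙ`-almost all `ζ`, `Q^{t,ζ}` solves the martingale problem
with respect to `χ` starting in `(t, ζ^t)`. -/
theorem regularConditional_solves_MP [TopologicalSpace.SeparableSpace E]
    [CompleteSpace E] [BorelSpace E]
    (χ : Set (ℝ≥0 → PathOmega E → ℝ)) (hχcount : χ.Countable)
    (hχcadlag : ∀ M ∈ χ, ∀ ω : PathOmega E, IsCadlag fun t => M t ω)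
    (hχadapted : ∀ M ∈ χ, ∀ t : ℝ≥0, Measurable[Fot E t] (M t))
    (hχbdd : ∀ T : ℝ≥0, ∃ C : ℝ, ∀ M ∈ χ, ∀ t ≤ T, ∀ ω : PathOmega E, |M t ω| ≤ C)
    (s : ℝ≥0) (η : PathOmega E) (hη : ∀ r : ℝ≥0, s ≤ r → η.1 r = η.1 s)
    (μ : Measure (PathOmega E)) (hμ : IsProbabilityMeasure μ)
    (hsol : SolvesMP E χ s η μ)
    (t : ℝ≥0) (hst : s ≤ t)
    (Q : PathOmega E → Measure (PathOmega E))
    (hQprob : ∀ ζ, IsProbabilityMeasure (Q ζ))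
    (hQmeas : ∀ F : Set (PathOmega E), MeasurableSet F →
      Measurable[Ft E t] fun ζ => Q ζ F)
    (hQcond : ∀ F : Set (PathOmega E), MeasurableSet F →
      ∀ G : Set (PathOmega E), MeasurableSet[Ft E t] G →
        ∫⁻ ζ in G, Q ζ F ∂μ = μ (F ∩ G)) :
    ∀ᵐ ζ ∂μ, SolvesMP E χ t ζ (Q ζ) := by
  refine .and ?_ ?_
  · filter_upwards [ae_ae_eq_path hQmeas hQcond] with ζ hζ
    rw [measure_congr (eventuallyEq_univ.2 hζ)]
    exact (hQprob ζ).measure_univ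
  have hmeas : ∀ M ∈ χ, ∀ u, Measurable (M u) := fun M hM u =>
    (hχadapted M hM u).mono (Fot_le u) le_rfl
  obtain ⟨D, hDc, hD⟩ := TopologicalSpace.exists_countable_dense ℝ≥0
  choose S hSc hSpi hSuniv hS using Fot_exists_countable_piSystem (E := E)
  have hint : ∀ (P : Measure (PathOmega E)) [IsFiniteMeasure P], ∀ M ∈ χ, ∀ u,
      Integrable (M u) P := fun P _ M hM u =>
    have ⟨C, hC⟩ := hχbdd u
    Integrable.of_bound (hmeas M hM u).aestronglyMeasurable C (ae_of_all _ (hC M hM u le_rfl))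
  have key : ∀ᵐ ζ ∂μ, ∀ M ∈ χ, ∀ q ∈ D, ∀ q' ∈ D, ∀ G ∈ S q, t < q → q < q' →
      ∫ ω in G, (M q' ω - M q ω) ∂(Q ζ) = 0 := by
    refine (ae_ball_iff hχcount).2 fun M hM => (ae_ball_iff hDc).2 fun q _ =>
      (ae_ball_iff hDc).2 fun q' _ => (ae_ball_iff (hSc q)).2 fun G hG => ?_
    by_cases hq : t < q ∧ q < q'
    swap
    · exact ae_of_all _ fun ζ h h' => absurd ⟨h, h'⟩ hq
    obtain ⟨htq, hqq'⟩ := hq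
    obtain ⟨C, hC⟩ := hχbdd q'
    have hGq : MeasurableSet[Fot E q] G := by
      rw [hS q]
      exact MeasurableSpace.measurableSet_generateFrom hG
    have hGm : MeasurableSet G := Fot_le q G hGq
    have hzero : ∀ᵐ ζ ∂μ, ∫ ω, G.indicator (fun ω => M q' ω - M q ω) ω ∂(Q ζ) = 0 := by
      refine ae_integral_eq_zero (Ft_le t) hQprob hQmeas hQcond (C := C + C)
        (((hmeas M hM q').sub (hmeas M hM q)).indicator hGm) (fun ω => ?_) fun H hH => ?_
      · refine (norm_indicator_le_norm_self (fun ω => M q' ω - M q ω) ω).trans ?_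
        exact (norm_sub_le _ _).trans
          (add_le_add (hC M hM q' le_rfl ω) (hC M hM q hqq'.le ω))
      · rw [setIntegral_indicator hGm,
          integral_sub (hint μ M hM q').integrableOn (hint μ M hM q).integrableOn, sub_eq_zero]
        exact (hsol.2 M hM).2 q q' (hst.trans htq.le) hqq'.le _
          (@MeasurableSet.inter _ (Fot E q) _ _ (Ft_le_Fot htq H hH) hGq)
    filter_upwards [hzero] with ζ hζ _ _
    rwa [integral_indicator hGm] at hζ
  filter_upwards [key] with ζ hζ M hM
  have := hQprob ζ
  refine isMartingaleOn_of_dense (hχcadlag M hM) (hmeas M hM)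
    (fun T => (hχbdd T).imp fun C hC => hC M hM) (Q ζ) hD fun q hq q' hq' htq hqq' G hG => ?_
  rw [← sub_eq_zero,
    ← integral_sub (hint (Q ζ) M hM q').integrableOn (hint (Q ζ) M hM q).integrableOn]
  exact setIntegral_eq_zero_of_piSystem (Fot_le q)
    ((hint (Q ζ) M hM q').sub (hint (Q ζ) M hM q)) (hS q) (hSpi q) (hSuniv q)
    (fun G hG => hζ M hM q hq q' hq' G hG htq hqq') G hG
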